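/- arXiv:1710.01349 — 9 statements merged into one kernel-verified Lean document; each statement's English description precedes it below -/
import Mathlib

section
/- Let k, n ≥ 2 be integers with (n−1)(k−1) ≥ 2. Then 2·#I_{k,n} = 2 + k^{n−1}·((k−1)(n−1) − 2); that is, the cardinality of the index set I_{k,n} of the standard basis equals the genus g_{k,n} = 1 + (k^{n−1}/2)·((k−1)(n−1) − 2) of a generalized Fermat curve of type (k,n). -/
/-- The coordinate sums of all tuples in `{0, …, k}ᵐ` average to `m * k / 2`. -/
theorem two_mul_sum_sum_fin (k m : ℕ) :
    2 * ∑ f : Fin m → Fin (k + 1), ∑ j, (f j : ℕ) = (k + 1) ^ m * (k * m) := by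
  have hrev : ∑ f : Fin m → Fin (k + 1), ∑ j, (f j : ℕ) =
      ∑ f : Fin m → Fin (k + 1), ∑ j, ((f j).rev : ℕ) :=
    ((Equiv.arrowCongr (Equiv.refl (Fin m)) Fin.revPerm).sum_comp
      fun f : Fin m → Fin (k + 1) => ∑ j, (f j : ℕ)).symm
  rw [two_mul]
  nth_rewrite 2 [hrev]
  rw [← Finset.sum_add_distrib]
  have hconst (f : Fin m → Fin (k + 1)) :
      ∑ j, (f j : ℕ) + ∑ j, ((f j).rev : ℕ) = k * m := by
    rw [← Finset.sum_add_distrib, Finset.sum_congr rfl (g := fun _ => k)]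
    · simp [mul_comm]
    · intro j _
      rw [Fin.val_rev]
      omega
  simp only [hconst]
  simp

theorem ncard_setOf_add_two_le {α : Type*} [Fintype α] (s : α → ℕ) :
    Set.ncard {p : ℕ × α | p.1 + 2 ≤ s p.2} = ∑ a, (s a - 1) := by
  let e : {p : ℕ × α | p.1 + 2 ≤ s p.2} ≃ Σ a, Fin (s a - 1) :=
    { toFun := fun p => ⟨p.1.2, p.1.1, by have := p.2; simp only [Set.mem_ofPred_eq] at this; omega⟩
      invFun := fun q => ⟨(q.2, q.1), by
        have := q.2.isLt; simp only [Set.mem_ofPred_eq]; omega⟩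
      left_inv := fun _ => rfl
      right_inv := fun _ => rfl }
  rw [← Nat.card_coe_set_eq, Nat.card_congr e]
  simp

theorem sum_sub_one_add_card_fin (k m : ℕ) :
    ∑ f : Fin m → Fin (k + 1), (∑ j, (f j : ℕ) - 1) + (k + 1) ^ m =
      ∑ f : Fin m → Fin (k + 1), ∑ j, (f j : ℕ) + 1 := by
  trans ∑ f : Fin m → Fin (k + 1), (∑ j, (f j : ℕ) - 1 + 1)
  · simp [Finset.sum_add_distrib]
  trans ∑ f : Fin m → Fin (k + 1), (∑ j, (f j : ℕ) + if f = 0 then 1 else 0)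
  swap
  · simp [Finset.sum_add_distrib]
  refine Finset.sum_congr rfl fun f _ => ?_
  have hf : ∑ j, (f j : ℕ) = 0 ↔ f = 0 := by
    simp [Finset.sum_eq_zero_iff, funext_iff]
  split_ifs with h0
  · simp [h0]
  · have := mt hf.1 h0
    omega


/-- For integers `k, n ≥ 2` with `(n-1)(k-1) ≥ 2`, the cardinality of the index set
`I_{k,n}` of tuples `(r; α₃,…,α_{n+1})` with `αⱼ ∈ {0,…,k-1}` and
`0 ≤ r ≤ α₃ + ⋯ + α_{n+1} - 2` equals the genus
`g_{k,n} = 1 + (k^{n-1}/2)((k-1)(n-1)-2)` of a generalized Fermat curve of type `(k,n)`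
(stated multiplied by 2 to stay in the integers). -/
theorem card_I_eq_genus (k n : ℕ) (hk : 2 ≤ k) (hn : 2 ≤ n)
    (h : 2 ≤ (n - 1) * (k - 1)) :
    2 * Set.ncard
        {p : ℕ × (Fin (n - 1) → Fin k) | p.1 + 2 ≤ ∑ j, (p.2 j : ℕ)} =
      2 + k ^ (n - 1) * ((k - 1) * (n - 1) - 2) := by
  obtain ⟨k, rfl⟩ := Nat.exists_eq_add_of_le' (show 1 ≤ k by omega)
  generalize n - 1 = m at *
  rw [ncard_setOf_add_two_le fun f : Fin m → Fin (k + 1) => ∑ j, (f j : ℕ)]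
  have hsum := two_mul_sum_sum_fin k m
  have hsub := sum_sub_one_add_card_fin k m
  rw [Nat.add_sub_cancel] at h ⊢
  obtain ⟨d, hd⟩ := Nat.exists_eq_add_of_le' h
  rw [mul_comm k m, hd] at hsum ⊢
  rw [Nat.add_sub_cancel]
  rw [mul_add] at hsum
  omega
end

section
/- Let k ≥ 3 be an odd integer and n ≥ 2 an integer with (n−1)(k−1) ≥ 2. Let B be the set of tuples (r; α₃,…,α_{n+1}) ∈ I_{k,n} such that r is even and every αⱼ is even. Then 2^{n+1} · #B = (n−1)·(k−1)·(k+1)^{n−1}. -/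
/-- Reversing every coordinate shows that the average of `∑ j, β j` over all
`β : Fin N → Fin (m + 1)` is `N * m / 2`. -/
theorem two_mul_sum_sum_fin_val (N m : ℕ) :
    2 * ∑ β : Fin N → Fin (m + 1), ∑ j, (β j : ℕ) = N * m * (m + 1) ^ N := by
  have hrev : ∑ β : Fin N → Fin (m + 1), ∑ j, ((β j).rev : ℕ) =
      ∑ β : Fin N → Fin (m + 1), ∑ j, (β j : ℕ) :=
    (Equiv.piCongrRight fun _ : Fin N => (Fin.revPerm : Equiv.Perm (Fin (m + 1)))).sum_comp
      fun β => ∑ j, (β j : ℕ)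
  have hconst (β : Fin N → Fin (m + 1)) :
      ∑ j, (β j : ℕ) + ∑ j, ((β j).rev : ℕ) = N * m := by
    rw [← Finset.sum_add_distrib, Finset.sum_congr rfl (g := fun _ => m)]
    · simp
    · intro j _
      rw [Fin.val_rev]
      omega
  rw [two_mul]
  nth_rewrite 2 [← hrev]
  rw [← Finset.sum_add_distrib, Finset.sum_congr rfl fun β _ => hconst β]
  simp [mul_comm]

/-- Halving all entries counts the even tuples below the coordinate sum. -/
theorem ncard_even_tuples (N m : ℕ) :
    Set.ncard {p : ℕ × (Fin N → Fin (2 * m + 1)) |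
        p.1 + 2 ≤ ∑ j, (p.2 j : ℕ) ∧ Even p.1 ∧ ∀ j, Even (p.2 j : ℕ)} =
      ∑ β : Fin N → Fin (m + 1), ∑ j, (β j : ℕ) := by
  let double : (Σ _ : Fin N → Fin (m + 1), ℕ) → ℕ × (Fin N → Fin (2 * m + 1)) :=
    fun x => (2 * x.2, fun j => ⟨2 * (x.1 j : ℕ), by have := (x.1 j).isLt; omega⟩)
  have hinj : Function.Injective double := by
    rintro ⟨β, s⟩ ⟨γ, t⟩ hst
    simp only [double, Prod.mk.injEq, funext_iff, Fin.mk.injEq] at hst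
    obtain rfl : β = γ := funext fun j => Fin.ext (by have := hst.2 j; omega)
    obtain rfl : s = t := by omega
    rfl
  have himage : {p : ℕ × (Fin N → Fin (2 * m + 1)) |
      p.1 + 2 ≤ ∑ j, (p.2 j : ℕ) ∧ Even p.1 ∧ ∀ j, Even (p.2 j : ℕ)} =
      double '' (Finset.univ.sigma fun β : Fin N → Fin (m + 1) =>
        Finset.range (∑ j, (β j : ℕ)) : Finset (Σ _ : Fin N → Fin (m + 1), ℕ)) := by
    ext ⟨r, α⟩
    simp only [Set.mem_ofPred_eq, Set.mem_image, Finset.mem_coe, Finset.mem_sigma,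
      Finset.mem_univ, true_and, Finset.mem_range]
    constructor
    · rintro ⟨hle, hr, hα⟩
      have htwo (j : Fin N) : 2 * ((α j : ℕ) / 2) = α j := Nat.two_mul_div_two_of_even (hα j)
      refine ⟨⟨fun j => ⟨(α j : ℕ) / 2, by have := (α j).isLt; omega⟩, r / 2⟩, ?_, ?_⟩
      · rw [← Finset.sum_congr rfl fun j _ => htwo j, ← Finset.mul_sum] at hle
        simp only
        omega
      · exact Prod.ext (Nat.two_mul_div_two_of_even hr) (funext fun j => Fin.ext (htwo j))
    · rintro ⟨⟨β, s⟩, hlt, hx⟩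
      obtain ⟨rfl, rfl⟩ := Prod.mk.inj hx
      refine ⟨?_, even_two_mul _, fun j => even_two_mul _⟩
      simp only [← Finset.mul_sum]
      simp only at hlt
      omega
  rw [himage, Set.ncard_image_of_injective _ hinj, Set.ncard_coe_finset, Finset.card_sigma]
  simp

/-- Let `k ≥ 3` be odd and `n ≥ 2` with `(n-1)(k-1) ≥ 2`. Let `B` be the set of tuples
`(r; α₃,…,α_{n+1})` in the index set `I_{k,n}` (i.e. `αⱼ ∈ {0,…,k-1}` and
`0 ≤ r ≤ α₃ + ⋯ + α_{n+1} - 2`) such that `r` and all `αⱼ` are even. Then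
`2^{n+1} · #B = (n-1)(k-1)(k+1)^{n-1}`. -/
theorem card_B (k n : ℕ) (hk : 3 ≤ k) (hkodd : Odd k) (hn : 2 ≤ n)
    (h : 2 ≤ (n - 1) * (k - 1)) :
    2 ^ (n + 1) * Set.ncard
        {p : ℕ × (Fin (n - 1) → Fin k) |
          p.1 + 2 ≤ ∑ j, (p.2 j : ℕ) ∧ Even p.1 ∧ ∀ j, Even (p.2 j : ℕ)} =
      (n - 1) * (k - 1) * (k + 1) ^ (n - 1) := by
  obtain ⟨m, rfl⟩ := hkodd
  obtain ⟨N, rfl⟩ : ∃ N, n = N + 1 := ⟨n - 1, by omega⟩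
  simp only [Nat.add_sub_cancel]
  rw [ncard_even_tuples]
  calc 2 ^ (N + 1 + 1) * ∑ β : Fin N → Fin (m + 1), ∑ j, (β j : ℕ)
      = 2 ^ (N + 1) * (2 * ∑ β : Fin N → Fin (m + 1), ∑ j, (β j : ℕ)) := by ring
    _ = N * (2 * m) * (2 * (m + 1)) ^ N := by rw [two_mul_sum_sum_fin_val, mul_pow]; ring
    _ = N * (2 * m) * (2 * m + 1 + 1) ^ N := by ring
end

section
/- Let K be a field, k ≥ 1 and n ≥ 2 integers, and λ₁,…,λ_{n−2} ∈ K pairwise distinct elements with λᵢ ∉ {0,1} for all i. Set μ₁ = 1 and μᵢ = λ_{i−1} for 2 ≤ i ≤ n−1. If a = (a₁,…,a_{n+1}) ∈ K^{n+1} satisfies μᵢ·a₁^k + a₂^k + a_{i+2}^k = 0 for all i = 1,…,n−1, and if aᵢ = aⱼ = 0 for two distinct indices i ≠ j in {1,…,n+1}, then a = 0. (In particular, every nonzero point of the generalized Fermat curve has at most one vanishing coordinate.) -/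
/-- A solution of the linear system `μᵢ b₀ + b₁ + b_{i+2} = 0`, with the `μᵢ` nonzero and pairwise
distinct, is zero as soon as two of its coordinates vanish. -/
theorem eq_zero_of_two_zero_coords {K : Type*} [Field K] {m : ℕ} {μ : Fin m → K}
    (hinj : Function.Injective μ) (hμ : ∀ i, μ i ≠ 0) {b : Fin (m + 2) → K}
    (heq : ∀ i : Fin m, μ i * b 0 + b 1 + b i.succ.succ = 0)
    {i j : Fin (m + 2)} (hij : i ≠ j) (hi : b i = 0) (hj : b j = 0) : b = 0 := by
  have of_fst_snd (h0 : b 0 = 0) (h1 : b 1 = 0) : b = 0 := by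
    funext l
    refine Fin.cases h0 (fun l => Fin.cases h1 (fun l => ?_) l) l
    simpa [h0, h1] using heq l
  have of_fst (h0 : b 0 = 0) {l : Fin (m + 1)} (hl : b l.succ = 0) : b = 0 := by
    refine of_fst_snd h0 ?_
    induction l using Fin.cases with
    | zero => exact hl
    | succ l => simpa [h0, hl] using heq l
  have of_snd (h1 : b 1 = 0) {l : Fin m} (hl : b l.succ.succ = 0) : b = 0 :=
    of_fst_snd (by simpa [h1, hl, hμ l] using heq l) h1
  induction i using Fin.cases with
  | zero =>
    obtain ⟨l, rfl⟩ := Fin.exists_succ_eq.2 hij.symm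
    exact of_fst hi hj
  | succ i =>
    induction j using Fin.cases with
    | zero => exact of_fst hj hi
    | succ j =>
      induction i using Fin.cases with
      | zero =>
        obtain ⟨l, rfl⟩ := Fin.exists_succ_eq.2 (fun h => hij (congrArg Fin.succ h.symm))
        exact of_snd hi hj
      | succ i =>
        induction j using Fin.cases with
        | zero => exact of_snd hj hi
        | succ j =>
          have hne : μ i - μ j ≠ 0 := sub_ne_zero.2 fun h => hij (by rw [hinj h])
          have h0 : b 0 = 0 := (mul_eq_zero.1 (by
            linear_combination heq i - heq j - hi + hj : (μ i - μ j) * b 0 = 0)).resolve_left hne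
          exact of_fst h0 hi


/-- Let `K` be a field, `k ≥ 1`, `n ≥ 2`, and `λ₁,…,λ_{n-2} ∈ K` pairwise distinct with
`λᵢ ∉ {0,1}`. Set `μ₁ = 1` and `μᵢ = λ_{i-1}` for `2 ≤ i ≤ n-1`. If
`a = (a₁,…,a_{n+1}) ∈ K^{n+1}` satisfies the generalized Fermat equations
`μᵢ a₁^k + a₂^k + a_{i+2}^k = 0` for `i = 1,…,n-1`, and two distinct coordinates of `a`
vanish, then `a = 0`. -/
theorem two_zero_coords_imp_zero (K : Type) [Field K] (k n : ℕ) (hk : 1 ≤ k) (hn : 2 ≤ n)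
    (lam : Fin (n - 2) → K) (hinj : Function.Injective lam)
    (hlam : ∀ i, lam i ≠ 0 ∧ lam i ≠ 1)
    (a : Fin (n + 1) → K)
    (heq : ∀ i : Fin (n - 1),
      (if h : (i : ℕ) = 0 then (1 : K)
        else lam ⟨(i : ℕ) - 1, by have := i.isLt; omega⟩) * a 0 ^ k
        + a 1 ^ k + a ⟨(i : ℕ) + 2, by have := i.isLt; omega⟩ ^ k = 0)
    (i j : Fin (n + 1)) (hij : i ≠ j) (hi : a i = 0) (hj : a j = 0) :
    a = 0 := by
  obtain ⟨m, rfl⟩ := Nat.exists_eq_add_of_le' hn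
  have hk0 : k ≠ 0 := Nat.one_le_iff_ne_zero.1 hk
  have hpow : (fun l => a l ^ k) = 0 := by
    refine eq_zero_of_two_zero_coords (μ := Fin.cons 1 lam)
      (Fin.cons_injective_iff.2 ⟨fun ⟨l, hl⟩ => (hlam l).2 hl, hinj⟩)
      (Fin.cases one_ne_zero fun l => (hlam l).1) (fun l => ?_) hij
      (by simp [hi, hk0]) (by simp [hj, hk0])
    induction l using Fin.cases with
    | zero => exact heq (0 : Fin (m + 1))
    | succ l => exact heq (Fin.succ l)
  funext l
  exact (pow_eq_zero_iff hk0).1 (congrFun hpow l)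
end

section
/- Let K be a field, k ≥ 2 an integer with k·1_K ≠ 0 in K (k not divisible by the characteristic), n ≥ 2 an integer, and λ₁,…,λ_{n−2} ∈ K pairwise distinct with λᵢ ∉ {0,1}. Set μ₁ = 1 and μᵢ = λ_{i−1} for 2 ≤ i ≤ n−1. Let a = (a₁,…,a_{n+1}) ∈ K^{n+1} be nonzero and satisfy μᵢ·a₁^k + a₂^k + a_{i+2}^k = 0 for all i = 1,…,n−1. Then the (n−1)×(n+1) Jacobian matrix J, with entries J_{i,1} = k·μᵢ·a₁^{k−1}, J_{i,2} = k·a₂^{k−1}, J_{i,i+2} = k·a_{i+2}^{k−1}, and all other entries 0, has rank n−1. (Hence the generalized Fermat curve C^k_{λ₁,…,λ_{n−2}} is non-singular.) -/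
/-- On a nonzero solution of `μ i * x ^ k + y ^ k + z i ^ k = 0` with the `μ i` distinct and nonzero,
the only vector annihilated by the columns of the Jacobian matrix is zero. -/
lemma eq_zero_of_jacobian_columns {K ι : Type*} [Field K] [Fintype ι] {k : ℕ} (hk : k ≠ 0)
    {μ : ι → K} (hμ : Function.Injective μ) (hμ0 : ∀ i, μ i ≠ 0) {x y : K} {z : ι → K}
    (heq : ∀ i, μ i * x ^ k + y ^ k + z i ^ k = 0) (hne : x = 0 → y = 0 → ¬ ∀ i, z i = 0)
    {v : ι → K} (hx : ∑ i, v i * (μ i * x ^ (k - 1)) = 0) (hy : ∑ i, v i * y ^ (k - 1) = 0)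
    (hz : ∀ i, v i * z i ^ (k - 1) = 0) : v = 0 := by
  have hxy : x = 0 → y ≠ 0 := by
    rintro rfl rfl
    refine hne rfl rfl fun i => ?_
    simpa [hk] using heq i
  by_contra hv
  obtain ⟨i, hi⟩ := Function.ne_iff.mp hv
  have hz0 : ∀ j, v j ≠ 0 → z j = 0 := fun j hj =>
    eq_zero_of_pow_eq_zero ((mul_eq_zero.mp (hz j)).resolve_left hj)
  have hvj : ∀ j, j ≠ i → v j = 0 := by
    intro j hji
    by_contra hj
    have hi' := heq i
    have hj' := heq j
    rw [hz0 i hi, zero_pow hk, add_zero] at hi'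
    rw [hz0 j hj, zero_pow hk, add_zero] at hj'
    have hx0 : x = 0 := by
      have h : (μ j - μ i) * x ^ k = 0 := by linear_combination hj' - hi'
      exact eq_zero_of_pow_eq_zero
        ((mul_eq_zero.mp h).resolve_left (sub_ne_zero.mpr (hμ.ne hji)))
    subst hx0
    exact hxy rfl (by simpa [hk] using hi')
  rw [Fintype.sum_eq_single i fun j hj => by rw [hvj j hj, zero_mul]] at hx hy
  have hx0 : x = 0 := eq_zero_of_pow_eq_zero
    ((mul_eq_zero.mp ((mul_eq_zero.mp hx).resolve_left hi)).resolve_left (hμ0 i))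
  exact hxy hx0 (eq_zero_of_pow_eq_zero ((mul_eq_zero.mp hy).resolve_left hi))


/-- Let `K` be a field, `k ≥ 2` with `k·1_K ≠ 0`, `n ≥ 2`, and `λ₁,…,λ_{n-2} ∈ K` pairwise
distinct with `λᵢ ∉ {0,1}`. Set `μ₁ = 1` and `μᵢ = λ_{i-1}` for `2 ≤ i ≤ n-1`. If
`a ∈ K^{n+1}` is nonzero and satisfies the generalized Fermat equations
`μᵢ a₁^k + a₂^k + a_{i+2}^k = 0` (`i = 1,…,n-1`), then the `(n-1) × (n+1)` Jacobian matrix,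
with `J_{i,1} = k μᵢ a₁^{k-1}`, `J_{i,2} = k a₂^{k-1}`, `J_{i,i+2} = k a_{i+2}^{k-1}` and all
other entries `0`, has rank `n-1`; hence the generalized Fermat curve is non-singular. -/
theorem jacobian_rank (K : Type) [Field K] (k n : ℕ) (hk : 2 ≤ k) (hkK : (k : K) ≠ 0)
    (hn : 2 ≤ n)
    (lam : Fin (n - 2) → K) (hinj : Function.Injective lam)
    (hlam : ∀ i, lam i ≠ 0 ∧ lam i ≠ 1)
    (a : Fin (n + 1) → K) (ha : a ≠ 0)
    (heq : ∀ i : Fin (n - 1),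
      (if h : (i : ℕ) = 0 then (1 : K)
        else lam ⟨(i : ℕ) - 1, by have := i.isLt; omega⟩) * a 0 ^ k
        + a 1 ^ k + a ⟨(i : ℕ) + 2, by have := i.isLt; omega⟩ ^ k = 0) :
    (Matrix.of fun (i : Fin (n - 1)) (l : Fin (n + 1)) =>
      if (l : ℕ) = 0 then
        (k : K) * (if h : (i : ℕ) = 0 then (1 : K)
          else lam ⟨(i : ℕ) - 1, by have := i.isLt; omega⟩) * a 0 ^ (k - 1)
      else if (l : ℕ) = 1 then (k : K) * a 1 ^ (k - 1)
      else if (l : ℕ) = (i : ℕ) + 2 then (k : K) * a l ^ (k - 1)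
      else 0).rank = n - 1 := by
  set μ : Fin (n - 1) → K := fun i => if h : (i : ℕ) = 0 then (1 : K)
    else lam ⟨(i : ℕ) - 1, by have := i.isLt; omega⟩ with hμdef
  have hμ0 : ∀ i, μ i ≠ 0 := by
    intro i
    by_cases h : (i : ℕ) = 0
    · simp [hμdef, h]
    · simpa [hμdef, h] using (hlam _).1
  have hμ : Function.Injective μ := by
    intro i j hij
    by_cases hi : (i : ℕ) = 0 <;> by_cases hj : (j : ℕ) = 0
    · exact Fin.ext (hi.trans hj.symm)
    · simp only [hμdef, hi, hj, dite_true, dite_false] at hij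
      exact absurd hij.symm (hlam _).2
    · simp only [hμdef, hi, hj, dite_true, dite_false] at hij
      exact absurd hij (hlam _).2
    · simp only [hμdef, hi, hj, dite_false] at hij
      have := Fin.mk.inj (hinj hij)
      exact Fin.ext (by omega)
  have hone : ((1 : Fin (n + 1)) : ℕ) = 1 := by
    rw [Fin.val_one', Nat.mod_eq_of_lt (by omega)]
  refine (LinearIndependent.rank_matrix ?_).trans (Fintype.card_fin _)
  rw [← Matrix.vecMul_injective_iff, ← Matrix.coe_vecMulLinear, injective_iff_map_eq_zero]
  intro v hv
  have hcol := fun l => congrFun hv l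
  simp only [Matrix.vecMulLinear_apply, Matrix.vecMul, dotProduct, Matrix.of_apply,
    Pi.zero_apply] at hcol
  refine eq_zero_of_jacobian_columns (by omega) hμ hμ0 heq ?_ ?_ ?_ ?_
  · intro h0 h1 hz
    refine ha (funext fun l => ?_)
    rcases Nat.lt_or_ge l 2 with hl | hl
    · rcases Nat.lt_or_ge l 1 with hl' | hl'
      · rw [show l = 0 from Fin.ext (Nat.lt_one_iff.mp hl'), h0, Pi.zero_apply]
      · rw [show l = 1 from Fin.ext (by omega), h1, Pi.zero_apply]
    · have := hz ⟨l - 2, by omega⟩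
      rwa [show (⟨(l : ℕ) - 2 + 2, by omega⟩ : Fin (n + 1)) = l from
        Fin.ext (Nat.sub_add_cancel hl)] at this
  · refine (mul_eq_zero.mp (Eq.trans ?_ (hcol 0))).resolve_left hkK
    rw [Finset.mul_sum]
    refine Finset.sum_congr rfl fun i _ => ?_
    rw [if_pos (by simp)]
    ring
  · refine (mul_eq_zero.mp (Eq.trans ?_ (hcol 1))).resolve_left hkK
    rw [Finset.mul_sum]
    refine Finset.sum_congr rfl fun i _ => ?_
    rw [if_neg (by omega), if_pos hone]
    ring
  · intro i
    refine (mul_eq_zero.mp (Eq.trans ?_ (hcol ⟨i + 2, by omega⟩))).resolve_left hkK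
    rw [Fintype.sum_eq_single i]
    · simp only [Nat.add_eq_zero_iff, OfNat.ofNat_ne_zero, and_false, if_false, if_true,
        Nat.reduceEqDiff]
      ring
    · intro j hj
      have : (i : ℕ) ≠ j := fun h => hj (Fin.ext h.symm)
      rw [if_neg (by simp), if_neg (by simp), if_neg (by simpa using this), mul_zero]
end

section
/- Let K be an algebraically closed field, k ≥ 2 an integer not divisible by the characteristic of K, n ≥ 2 an integer, and λ₁,…,λ_{n−2} ∈ K pairwise distinct with λᵢ ∉ {0,1}. Set μ₁ = 1 and μᵢ = λ_{i−1} for 2 ≤ i ≤ n−1. Then the ideal of the polynomial ring K[x₁,…,x_{n+1}] generated by the n−1 polynomials Fᵢ = μᵢ·x₁^k + x₂^k + x_{i+2}^k (i = 1,…,n−1) is a prime ideal. (Hence the generalized Fermat curve C^k_{λ₁,…,λ_{n−2}} ⊂ ℙ^n_K is irreducible.) -/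
open MvPolynomial

theorem prime_X_pow_sub_C_of_eisenstein {R E : Type*} [CommRing R] [Field E]
    {φ : R →+* PowerSeries E} (hφ : Function.Injective φ) {k : ℕ} (hk : 0 < k) {a : R}
    (h0 : PowerSeries.constantCoeff (φ a) = 0) (h1 : PowerSeries.coeff 1 (φ a) ≠ 0) :
    Prime (Polynomial.X ^ k - Polynomial.C a : Polynomial R) := by
  have hmon : (Polynomial.X ^ k - Polynomial.C a : Polynomial R).Monic :=
    Polynomial.monic_X_pow_sub_C a hk.ne'
  have hmon' := Polynomial.monic_X_pow_sub_C (φ a) hk.ne'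
  have hmap : (Polynomial.X ^ k - Polynomial.C a : Polynomial R).map φ =
      Polynomial.X ^ k - Polynomial.C (φ a) := by simp
  have hprime : (Ideal.span {(PowerSeries.X : PowerSeries E)}).IsPrime :=
    PowerSeries.span_X_isPrime
  have heis : (Polynomial.X ^ k - Polynomial.C (φ a)).IsEisensteinAt
      (Ideal.span {(PowerSeries.X : PowerSeries E)}) := by
    refine ⟨?_, ?_, ?_⟩
    · rw [hmon'.leadingCoeff]
      exact (Ideal.ne_top_iff_one _).1 hprime.ne_top
    · intro n hn
      rw [Polynomial.natDegree_X_pow_sub_C] at hn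
      rw [Polynomial.coeff_sub, Polynomial.coeff_X_pow, if_neg hn.ne, Polynomial.coeff_C, zero_sub,
        neg_mem_iff]
      split_ifs
      · exact Ideal.mem_span_singleton.2 (PowerSeries.X_dvd_iff.2 h0)
      · exact zero_mem _
    · rw [Polynomial.coeff_sub, Polynomial.coeff_X_pow, if_neg hk.ne, Polynomial.coeff_C_zero,
        zero_sub, neg_mem_iff, Ideal.span_singleton_pow, Ideal.mem_span_singleton,
        PowerSeries.X_pow_dvd_iff]
      exact fun h => h1 (h 1 one_lt_two)
  have hirr : Prime (Polynomial.X ^ k - Polynomial.C (φ a)) :=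
    (heis.irreducible hprime hmon'.isPrimitive
      (by rwa [Polynomial.natDegree_X_pow_sub_C])).prime
  rw [← hmap] at hirr
  refine ⟨fun h => hirr.ne_zero (by rw [h, Polynomial.map_zero]),
    fun h => hirr.not_isUnit (h.map (Polynomial.mapRingHom φ)), fun p q hpq => ?_⟩
  have := hirr.dvd_or_dvd (a := p.map φ) (b := q.map φ)
    (by rw [← Polynomial.map_mul]; exact Polynomial.map_dvd φ hpq)
  rwa [Polynomial.map_dvd_map φ hφ hmon, Polynomial.map_dvd_map φ hφ hmon] at this

theorem AdjoinRoot.lift_injective_of_prime {R S : Type*} [CommRing R] [CommRing S] [IsDomain S]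
    {f : Polynomial R} (hf : Prime f) (hmon : f.Monic) {φ : R →+* S}
    (hφ : Function.Injective φ) {b : S} (hb : f.eval₂ φ b = 0) :
    Function.Injective (AdjoinRoot.lift φ b hb) := by
  have : IsDomain (AdjoinRoot f) := AdjoinRoot.isDomain_of_prime hf
  have : Nontrivial R := hφ.isDomain.toNontrivial
  have : Algebra.IsIntegral R (AdjoinRoot f) :=
    ⟨fun x => by
      have := hmon.finite_adjoinRoot
      exact Algebra.IsIntegral.isIntegral x⟩
  rw [RingHom.injective_iff_ker_eq_bot]
  refine Ideal.eq_bot_of_comap_eq_bot (R := R) ?_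
  rw [RingHom.comap_ker, AdjoinRoot.algebraMap_eq, AdjoinRoot.lift_comp_of]
  exact (RingHom.injective_iff_ker_eq_bot _).1 hφ

/-- Kummer-type criterion: the ideal `(xᵢ ^ k - aᵢ)ᵢ` is prime if for each `j` there is an
embedding into a ring of power series under which `a j` has order one while all the other `a i`
become `k`-th powers. -/
theorem isPrime_span_X_pow_sub_C {E ι : Type*} [Field E] [Finite ι] {k : ℕ} (hk : 0 < k) :
    ∀ (R : Type) [CommRing R] [IsDomain R] (a : ι → R),
      (∀ j, ∃ φ : R →+* PowerSeries E, Function.Injective φ ∧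
        PowerSeries.constantCoeff (φ (a j)) = 0 ∧ PowerSeries.coeff 1 (φ (a j)) ≠ 0 ∧
        ∀ i ≠ j, ∃ b, b ^ k = φ (a i)) →
      (Ideal.span (Set.range fun i => (X i ^ k - C (a i) : MvPolynomial ι R))).IsPrime := by
  induction ι using Finite.induction_empty_option with
  | @of_equiv α β e ih =>
    intro R _ _ a h
    have := ih R (a ∘ e) fun j => by
      obtain ⟨φ, hφ, h0, h1, h2⟩ := h (e j)
      exact ⟨φ, hφ, h0, h1, fun i hi => h2 (e i) (by simpa using hi)⟩
    have := Ideal.map_isPrime_of_equiv (renameEquiv R e)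
      (I := Ideal.span (Set.range fun i => (X i ^ k - C ((a ∘ e) i) : MvPolynomial α R)))
    rw [Ideal.map_span, ← Set.range_comp] at this
    convert this using 2
    rw [← e.surjective.range_comp]
    congr 1
    ext1 i
    simp
  | h_empty =>
    intro R _ _ a _
    rw [Set.range_eq_empty, Ideal.span_empty]
    exact Ideal.isPrime_bot
  | @h_option α _ ih =>
    intro R _ _ a h
    set f : Polynomial R := Polynomial.X ^ k - Polynomial.C (a none) with hf
    have hmon : f.Monic := Polynomial.monic_X_pow_sub_C _ hk.ne'
    have hprime : Prime f := by
      obtain ⟨φ, hφ, h0, h1, -⟩ := h none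
      exact prime_X_pow_sub_C_of_eisenstein hφ hk h0 h1
    have : IsDomain (AdjoinRoot f) := AdjoinRoot.isDomain_of_prime hprime
    have hJ := ih (AdjoinRoot f) (fun i => AdjoinRoot.of f (a (some i))) fun j => by
      obtain ⟨φ, hφ, h0, h1, h2⟩ := h (some j)
      obtain ⟨b, hb⟩ := h2 none (by simp)
      have hfb : f.eval₂ φ b = 0 := by simp [hf, hb]
      refine ⟨AdjoinRoot.lift φ b hfb, AdjoinRoot.lift_injective_of_prime hprime hmon hφ hfb,
        by simpa using h0, by simpa using h1, fun i hi => ?_⟩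
      obtain ⟨c, hc⟩ := h2 (some i) (by simpa using hi)
      exact ⟨c, by simpa using hc⟩
    let g : MvPolynomial α (Polynomial R) →+* MvPolynomial α (AdjoinRoot f) :=
      MvPolynomial.map (AdjoinRoot.mk f)
    let ψ : MvPolynomial (Option α) R →+* MvPolynomial α (AdjoinRoot f) :=
      g.comp (optionEquivRight R α).toRingEquiv.toRingHom
    have hψs : Function.Surjective ψ :=
      (MvPolynomial.map_surjective _ AdjoinRoot.mk_surjective).comp
        (optionEquivRight R α).surjective
    have hψsome (i : α) : ψ (X (some i) ^ k - C (a (some i))) =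
        X i ^ k - C (AdjoinRoot.of f (a (some i))) := by
      simp [ψ, g]
    have hψe : optionEquivRight R α (X none ^ k - C (a none)) = C f := by
      rw [map_sub, map_pow, optionEquivRight_X_none, optionEquivRight_C, hf, C_sub, C_pow]
    have hψnone : ψ (X none ^ k - C (a none)) = 0 := by
      change g (optionEquivRight R α (X none ^ k - C (a none))) = 0
      rw [hψe]
      simp [g]
    set I := Ideal.span (Set.range fun i => (X i ^ k - C (a i) : MvPolynomial (Option α) R))
      with hI
    have hmap : I.map ψ = Ideal.span (Set.range fun i =>
        (X i ^ k - C (AdjoinRoot.of f (a (some i))) : MvPolynomial α (AdjoinRoot f))) := by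
      rw [hI, Ideal.map_span, ← Set.range_comp]
      apply le_antisymm
      · rw [Ideal.span_le]
        rintro _ ⟨i | i, rfl⟩
        · simp only [Function.comp_apply, hψnone]
          exact zero_mem _
        · simp only [Function.comp_apply, hψsome]
          exact Ideal.subset_span ⟨i, rfl⟩
      · apply Ideal.span_mono
        rintro _ ⟨i, rfl⟩
        exact ⟨some i, hψsome i⟩
    have hker : RingHom.ker ψ ≤ I := by
      intro p hp
      have hp' : optionEquivRight R α p ∈ RingHom.ker g := hp
      rw [MvPolynomial.ker_map, show RingHom.ker (AdjoinRoot.mk f) = _ from Ideal.mk_ker, Ideal.map_span, Set.image_singleton,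
        Ideal.mem_span_singleton] at hp'
      obtain ⟨q, hq⟩ := hp'
      have : p = (X none ^ k - C (a none)) * (optionEquivRight R α).symm q := by
        apply (optionEquivRight R α).injective
        rw [map_mul, hψe, hq, AlgEquiv.apply_symm_apply]
      rw [this]
      exact I.mul_mem_right _ (Ideal.subset_span ⟨none, rfl⟩)
    have hcomap : I = (I.map ψ).comap ψ := by
      rw [Ideal.comap_map_of_surjective ψ hψs, ← RingHom.ker_eq_comap_bot, sup_eq_left.2 hker]
    rw [hcomap, hmap]
    exact Ideal.comap_isPrime ψ _

theorem PowerSeries.exists_pow_eq {E : Type*} [Field E] {k : ℕ} (hk : (k : E) ≠ 0)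
    {g : PowerSeries E} {c : E} (hc : c ≠ 0) (hg : c ^ k = PowerSeries.constantCoeff g) :
    ∃ b, b ^ k = g := by
  have hk0 : k ≠ 0 := by rintro rfl; simp at hk
  obtain ⟨b, hb, -⟩ := HenselianRing.is_henselian
    (I := Ideal.span {(PowerSeries.X : PowerSeries E)})
    (Polynomial.X ^ k - Polynomial.C g) (Polynomial.monic_X_pow_sub_C _ hk0) (PowerSeries.C c)
    (by
      rw [Ideal.mem_span_singleton, PowerSeries.X_dvd_iff]
      simp [hg])
    (by
      refine IsUnit.map _ (PowerSeries.isUnit_iff_constantCoeff.2 ?_)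
      simp [Polynomial.derivative_X_pow, hk, hc])
  exact ⟨b, by simpa [sub_eq_zero] using hb⟩

/-- The embedding of `K[x₀, x₁]` into power series over `K(t)` sending `x₁` to `t` and `x₀` to
`c t + u`, where `u` is the power series variable. -/
noncomputable def lineExpansion (K : Type*) [Field K] (c : K) :
    MvPolynomial (Fin 2) K →+* PowerSeries (FractionRing (MvPolynomial (Fin 1) K)) :=
  Polynomial.coeToPowerSeries.ringHom.comp
    ((Polynomial.taylorAlgHom (algebraMap (MvPolynomial (Fin 1) K) _ (C c * X 0))).toRingHom.comp
      ((Polynomial.mapRingHom (algebraMap (MvPolynomial (Fin 1) K) _)).comp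
        (finSuccEquiv K 1).toRingEquiv.toRingHom))

theorem lineExpansion_injective {K : Type*} [Field K] (c : K) :
    Function.Injective (lineExpansion K c) :=
  (Polynomial.coe_injective _).comp <| (Polynomial.taylor_injective _).comp <|
    (Polynomial.map_injective _ (IsFractionRing.injective _ _)).comp (finSuccEquiv K 1).injective

theorem lineExpansion_apply {K : Type*} [Field K] (c m : K) (k : ℕ) :
    lineExpansion K c (-(C m * X 0 ^ k + X 1 ^ k)) =
      (Polynomial.taylor (algebraMap (MvPolynomial (Fin 1) K) _ (C c * X 0))
        (-(Polynomial.C (algebraMap (MvPolynomial (Fin 1) K) _ (C m)) * Polynomial.X ^ k +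
          Polynomial.C (algebraMap (MvPolynomial (Fin 1) K)
            (FractionRing (MvPolynomial (Fin 1) K)) (X 0)) ^ k)) : Polynomial _) := by
  have h1 : finSuccEquiv K 1 (X 1) = Polynomial.C (X 0) := finSuccEquiv_X_succ (j := 0)
  have h : (finSuccEquiv K 1) (-(C m * X 0 ^ k + X 1 ^ k)) =
      -(Polynomial.C (C m) * Polynomial.X ^ k + Polynomial.C (X 0) ^ k) := by
    have h2 (x : K) : finSuccEquiv K 1 (C x) = Polynomial.C (C x) :=
      (finSuccEquiv K 1).commutes x
    simp only [map_neg, map_add, map_mul, map_pow, finSuccEquiv_X_zero, h1, h2]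
  change Polynomial.toPowerSeries (Polynomial.taylor _ ((finSuccEquiv K 1 _).map _)) = _
  rw [h]
  simp

theorem constantCoeff_lineExpansion {K : Type*} [Field K] (c m : K) (k : ℕ) :
    PowerSeries.constantCoeff (lineExpansion K c (-(C m * X 0 ^ k + X 1 ^ k))) =
      algebraMap (MvPolynomial (Fin 1) K) _ (C (-(m * c ^ k + 1)) * X 0 ^ k) := by
  rw [lineExpansion_apply, ← PowerSeries.coeff_zero_eq_constantCoeff_apply, Polynomial.coeff_coe,
    Polynomial.taylor_coeff_zero]
  simp only [Polynomial.eval_neg, Polynomial.eval_add, Polynomial.eval_mul, Polynomial.eval_C,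
    Polynomial.eval_pow, Polynomial.eval_X, map_mul, map_pow, map_neg, map_add, map_one]
  ring

theorem coeff_one_lineExpansion {K : Type*} [Field K] (c m : K) (k : ℕ) :
    PowerSeries.coeff 1 (lineExpansion K c (-(C m * X 0 ^ k + X 1 ^ k))) =
      algebraMap (MvPolynomial (Fin 1) K) _ (C (-(m * k * c ^ (k - 1))) * X 0 ^ (k - 1)) := by
  rw [lineExpansion_apply, Polynomial.coeff_coe, Polynomial.taylor_coeff_one]
  rw [← Polynomial.C_pow]
  simp only [Polynomial.derivative_neg, Polynomial.derivative_add, Polynomial.derivative_C,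
    Polynomial.derivative_C_mul, Polynomial.derivative_X_pow, Polynomial.eval_neg,
    Polynomial.eval_add, Polynomial.eval_zero, Polynomial.eval_mul, Polynomial.eval_C,
    Polynomial.eval_pow, Polynomial.eval_X]
  simp only [map_mul, map_pow, map_neg, map_natCast]
  ring

theorem isPrime_span_fermat {K : Type} [Field K] [IsAlgClosed K] {k : ℕ} (hk : (k : K) ≠ 0)
    {ι : Type*} [Finite ι] {μ : ι → K} (hμ : Function.Injective μ) (hμ0 : ∀ i, μ i ≠ 0) :
    (Ideal.span (Set.range fun i =>
      (X i ^ k - C (-(C (μ i) * X 0 ^ k + X 1 ^ k)) :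
        MvPolynomial ι (MvPolynomial (Fin 2) K)))).IsPrime := by
  have hk0 : 0 < k := Nat.pos_of_ne_zero (by rintro rfl; simp at hk)
  refine isPrime_span_X_pow_sub_C (E := FractionRing (MvPolynomial (Fin 1) K)) hk0 _ _ fun j => ?_
  obtain ⟨c, hc⟩ := IsAlgClosed.exists_pow_nat_eq (-(μ j)⁻¹) hk0
  have hμc : μ j * c ^ k = -1 := by rw [hc, mul_neg, mul_inv_cancel₀ (hμ0 j)]
  have hc0 : c ≠ 0 := by
    rintro rfl
    simp [hk0.ne'] at hμc
  have hinj := IsFractionRing.injective (MvPolynomial (Fin 1) K)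
    (FractionRing (MvPolynomial (Fin 1) K))
  refine ⟨lineExpansion K c, lineExpansion_injective c, ?_, ?_, fun i hij => ?_⟩
  · rw [constantCoeff_lineExpansion, hμc]
    simp
  · rw [coeff_one_lineExpansion, map_ne_zero_iff _ hinj]
    refine mul_ne_zero ?_ (pow_ne_zero _ (X_ne_zero _))
    rw [Ne, MvPolynomial.C_eq_zero, neg_eq_zero]
    exact mul_ne_zero (mul_ne_zero (hμ0 j) hk) (pow_ne_zero _ hc0)
  · obtain ⟨d, hd⟩ := IsAlgClosed.exists_pow_nat_eq (-(μ i * c ^ k + 1)) hk0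
    have hd0 : d ≠ 0 := by
      rintro rfl
      rw [zero_pow hk0.ne', zero_eq_neg, ← neg_neg (1 : K), ← hμc, ← sub_eq_add_neg,
        ← sub_mul] at hd
      exact mul_ne_zero (sub_ne_zero.2 (hμ.ne hij)) (pow_ne_zero _ hc0) hd
    refine PowerSeries.exists_pow_eq (c := algebraMap (MvPolynomial (Fin 1) K) _ (C d * X 0))
      ?_ ?_ ?_
    · rw [← map_natCast (algebraMap (MvPolynomial (Fin 1) K) _), map_ne_zero_iff _ hinj,
        ← map_natCast (C : K →+* _), Ne, MvPolynomial.C_eq_zero]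
      exact hk
    · rw [map_ne_zero_iff _ hinj]
      exact mul_ne_zero (by rwa [Ne, MvPolynomial.C_eq_zero]) (X_ne_zero _)
    · rw [constantCoeff_lineExpansion, ← map_pow, mul_pow, ← C_pow, hd]

/-- Let `K` be an algebraically closed field, `k ≥ 2` not divisible by the characteristic of
`K`, `n ≥ 2`, and `λ₁,…,λ_{n-2} ∈ K` pairwise distinct with `λᵢ ∉ {0,1}`. Set `μ₁ = 1` and
`μᵢ = λ_{i-1}` for `2 ≤ i ≤ n-1`. Then the ideal of `K[x₁,…,x_{n+1}]` generated by the
polynomials `Fᵢ = μᵢ x₁^k + x₂^k + x_{i+2}^k` (`i = 1,…,n-1`) is prime; hence the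
generalized Fermat curve `C^k_{λ₁,…,λ_{n-2}} ⊂ ℙⁿ_K` is irreducible. -/
theorem fermat_ideal_isPrime (K : Type) [Field K] [IsAlgClosed K] (k n : ℕ)
    (hk : 2 ≤ k) (hkK : (k : K) ≠ 0) (hn : 2 ≤ n)
    (lam : Fin (n - 2) → K) (hinj : Function.Injective lam)
    (hlam : ∀ i, lam i ≠ 0 ∧ lam i ≠ 1) :
    (Ideal.span (Set.range (fun i : Fin (n - 1) =>
      ((C (if h : (i : ℕ) = 0 then (1 : K)
          else lam ⟨(i : ℕ) - 1, by have := i.isLt; omega⟩)) * X 0 ^ k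
        + X 1 ^ k + X (⟨(i : ℕ) + 2, by have := i.isLt; omega⟩ : Fin (n + 1)) ^ k :
        MvPolynomial (Fin (n + 1)) K)))).IsPrime := by
  obtain ⟨m, rfl⟩ : ∃ m, n = m + 1 := ⟨n - 1, by omega⟩
  let μ : Fin m → K := fun i =>
    if h : (i : ℕ) = 0 then 1 else lam ⟨(i : ℕ) - 1, by have := i.isLt; omega⟩
  have hμ0 (i) : μ i ≠ 0 := by
    by_cases h : (i : ℕ) = 0
    · simp [μ, h]
    · simpa [μ, h] using (hlam _).1
  have hμ : Function.Injective μ := by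
    intro i j hij
    by_cases hi : (i : ℕ) = 0 <;> by_cases hj : (j : ℕ) = 0
    · exact Fin.ext (hi.trans hj.symm)
    · simp only [μ, hi, hj, dite_true, dite_false] at hij
      exact absurd hij.symm (hlam _).2
    · simp only [μ, hi, hj, dite_true, dite_false] at hij
      exact absurd hij (hlam _).2
    · simp only [μ, hi, hj, dite_false] at hij
      have := congrArg Fin.val (hinj hij)
      simp only at this
      exact Fin.ext (by omega)
  let σ : Fin m ⊕ Fin 2 ≃ Fin (m + 1 + 1) :=
    (Equiv.sumComm _ _).trans (finSumFinEquiv.trans (finCongr (by omega)))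
  have hσl (i : Fin m) : σ (.inl i) = ⟨(i : ℕ) + 2, by omega⟩ :=
    Fin.ext (by simp [σ])
  have hσ0 : σ (.inr 0) = 0 := Fin.ext (by simp [σ])
  have hσ1 : σ (.inr 1) = 1 := Fin.ext (by simp [σ])
  let e := (sumAlgEquiv K (Fin m) (Fin 2)).symm.trans (renameEquiv K σ)
  have hprime := isPrime_span_fermat hkK hμ hμ0
  have := Ideal.map_isPrime_of_equiv e (I := Ideal.span (Set.range fun i =>
      (X i ^ k - C (-(C (μ i) * X 0 ^ k + X 1 ^ k)) :
        MvPolynomial (Fin m) (MvPolynomial (Fin 2) K))))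
  rw [Ideal.map_span, ← Set.range_comp] at this
  convert this using 1
  congr 2
  ext1 i
  simp only [e, Function.comp_apply, AlgEquiv.trans_apply, map_neg, map_add, map_mul,
    map_pow, sumAlgEquiv_symm_X, sumAlgEquiv_symm_C_C, sumAlgEquiv_symm_C_X, renameEquiv_apply,
    rename_X, rename_C, hσl, hσ0, hσ1, sub_neg_eq_add]
  exact add_comm _ _
end

section
/- Let K be an algebraically closed field, k ≥ 2 an integer not divisible by the characteristic of K, n ≥ 2 an integer, and λ₁,…,λ_{n−2} ∈ K pairwise distinct with λᵢ ∉ {0,1}. Set μ₁ = 1 and μᵢ = λ_{i−1} for 2 ≤ i ≤ n−1, and let C ⊂ ℙ^n_K be the set of projective points [x₁:…:x_{n+1}] satisfying μᵢ·x₁^k + x₂^k + x_{i+2}^k = 0 for i = 1,…,n−1. Let ω ∈ K satisfy ω^k = 1 and ω ≠ 1, and let a_{n+1} be the automorphism [x₁:…:x_{n+1}] ↦ [x₁:…:xₙ: ω·x_{n+1}] of ℙ^n_K. Then a point of C is fixed by a_{n+1} if and only if its last coordinate x_{n+1} vanishes, and the set of points of C with x_{n+1} = 0 has exactly k^{n−1}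 elements. -/
/-- The points `v` of the affine cone over the generalized Fermat curve of type `(k, m + 2)` with
parameters `M` whose last coordinate vanishes. -/
def FermatConeLastZero {K : Type*} [Field K] (k : ℕ) {m : ℕ} (M : Fin (m + 1) → K)
    (v : Fin (m + 3) → K) : Prop :=
  (∀ i : Fin (m + 1), M i * v 0 ^ k + v 1 ^ k + v i.succ.succ ^ k = 0) ∧ v (Fin.last _) = 0

theorem ncard_pow_eq {K : Type*} [Field K] [IsAlgClosed K] {k : ℕ} (hkK : (k : K) ≠ 0)
    {a : K} (ha : a ≠ 0) : Set.ncard {x : K | x ^ k = a} = k := by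
  classical
  have hk : 0 < k := Nat.pos_of_ne_zero (by rintro rfl; simp at hkK)
  have hsep := Polynomial.separable_X_pow_sub_C a hkK ha
  have hset : {x : K | x ^ k = a} = ((Polynomial.nthRoots k a).toFinset : Set K) := by
    ext x
    simp [Polynomial.mem_nthRoots hk]
  rw [hset, Set.ncard_coe_finset, Polynomial.nthRoots,
    Multiset.toFinset_card_of_nodup (Polynomial.nodup_roots hsep)]
  exact ((IsAlgClosed.splits _).natDegree_eq_card_roots.symm).trans
    (Polynomial.natDegree_X_pow_sub_C)

theorem ncard_forall_pow_eq {K : Type*} [Field K] [IsAlgClosed K] {k : ℕ} (hkK : (k : K) ≠ 0)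
    {m : ℕ} {a : Fin m → K} (ha : ∀ j, a j ≠ 0) :
    Set.ncard {w : Fin m → K | ∀ j, w j ^ k = a j} = k ^ m := by
  have hpi : {w : Fin m → K | ∀ j, w j ^ k = a j}
      = Set.univ.pi fun j => {x : K | x ^ k = a j} := by
    ext w
    simp
  rw [hpi, ← Nat.card_coe_set_eq, Nat.card_congr (Equiv.Set.univPi _), Nat.card_pi]
  simp [Nat.card_coe_set_eq, ncard_pow_eq hkK (ha _)]

namespace FermatConeLastZero

variable {K : Type*} [Field K] {k m : ℕ} {M : Fin (m + 1) → K}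

theorem smul {v : Fin (m + 3) → K} (h : FermatConeLastZero k M v) (c : K) :
    FermatConeLastZero k M (c • v) := by
  refine ⟨fun i => ?_, by simp [h.2]⟩
  simp only [Pi.smul_apply, smul_eq_mul, mul_pow]
  linear_combination c ^ k * h.1 i

theorem cons_snoc_iff (hk : k ≠ 0) (w : Fin (m + 1) → K) :
    FermatConeLastZero k M (Fin.cons 1 (Fin.snoc w 0 : Fin (m + 2) → K) : Fin (m + 3) → K) ↔
      ∀ j, w j ^ k =
        (Fin.cons (-M (Fin.last m)) (fun i => M (Fin.last m) - M i.castSucc) :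
          Fin (m + 1) → K) j := by
  have h1 : (Fin.cons 1 (Fin.snoc w 0 : Fin (m + 2) → K) : Fin (m + 3) → K) 1 = w 0 :=
    Fin.snoc_castSucc (α := fun _ => K) 0 w 0
  have hmid (i : Fin m) : (Fin.snoc w 0 : Fin (m + 2) → K) i.castSucc.succ = w i.succ := by
    rw [Fin.succ_castSucc]
    exact Fin.snoc_castSucc (α := fun _ => K) 0 w i.succ
  have hlast : (Fin.snoc w 0 : Fin (m + 2) → K) (Fin.last m).succ = 0 :=
    Fin.snoc_last (α := fun _ => K) 0 w
  have hend : (Fin.cons 1 (Fin.snoc w 0 : Fin (m + 2) → K) : Fin (m + 3) → K)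
      (Fin.last (m + 2)) = 0 := by
    rw [← Fin.succ_last, Fin.cons_succ, ← Fin.succ_last, hlast]
  rw [FermatConeLastZero, and_iff_left hend, Fin.forall_fin_succ', Fin.forall_fin_succ, h1]
  simp only [Fin.cons_succ, Fin.cons_zero, hmid, hlast, one_pow, mul_one,
    zero_pow hk, add_zero]
  constructor
  · rintro ⟨h, h0⟩
    exact ⟨by linear_combination h0, fun i => by linear_combination h i - h0⟩
  · rintro ⟨h0, h⟩
    exact ⟨fun i => by linear_combination h i + h0, by linear_combination h0⟩

theorem apply_zero_ne_zero (hk : k ≠ 0) {v : Fin (m + 3) → K}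
    (h : FermatConeLastZero k M v) (hv : v ≠ 0) : v 0 ≠ 0 := by
  intro h0
  have h1 : v 1 = 0 := by
    have hl := h.1 (Fin.last m)
    rw [Fin.succ_last, Fin.succ_last, h.2, h0] at hl
    simpa [hk] using hl
  refine hv (funext fun j => ?_)
  refine Fin.cases h0 (fun j => Fin.cases h1 (fun i => ?_) j) j
  simpa [h0, h1, hk] using h.1 i

theorem ncard_projectivization [IsAlgClosed K] (hkK : (k : K) ≠ 0)
    (hinj : Function.Injective M) (hM : ∀ i, M i ≠ 0) :
    Set.ncard {P : Projectivization K (Fin (m + 3) → K) |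
      ∀ (v : Fin (m + 3) → K) (hv : v ≠ 0), Projectivization.mk K v hv = P →
        FermatConeLastZero k M v} = k ^ (m + 1) := by
  have hk : k ≠ 0 := by rintro rfl; simp at hkK
  have hne (w : Fin (m + 1) → K) :
      (Fin.cons 1 (Fin.snoc w 0 : Fin (m + 2) → K) : Fin (m + 3) → K) ≠ 0 :=
    fun h => one_ne_zero (congrFun h 0)
  let a : Fin (m + 1) → K :=
    Fin.cons (-M (Fin.last m)) fun i => M (Fin.last m) - M i.castSucc
  have ha : ∀ j, a j ≠ 0 := by
    refine Fin.cases (neg_ne_zero.2 (hM _)) fun i => sub_ne_zero.2 fun h => ?_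
    exact (Fin.castSucc_lt_last i).ne' (hinj h)
  let f (w : Fin (m + 1) → K) : Projectivization K (Fin (m + 3) → K) :=
    Projectivization.mk K _ (hne w)
  have hf : Function.Injective f := by
    intro w w' h
    obtain ⟨c, hc⟩ := (Projectivization.mk_eq_mk_iff' K _ _ _ _).1 h
    have hc1 : c = 1 := by simpa using congrFun hc 0
    rw [hc1, one_smul] at hc
    exact (Fin.snoc_inj.1 (Fin.cons_inj.1 hc).2).1.symm
  rw [← ncard_forall_pow_eq hkK ha, ← Set.ncard_image_of_injective _ hf]
  congr 1
  ext P
  constructor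
  · intro hP
    induction P using Projectivization.ind with
    | h v hv =>
      have hv' := hP v hv rfl
      have h0 := hv'.apply_zero_ne_zero hk hv
      have hrep : (Fin.cons 1 (Fin.snoc (fun j : Fin (m + 1) => (v 0)⁻¹ * v j.castSucc.succ) 0 :
          Fin (m + 2) → K) : Fin (m + 3) → K) = (v 0)⁻¹ • v := by
        refine funext (Fin.cases (by simp [h0]) (Fin.lastCases ?_ fun j => ?_))
        · simp [hv'.2]
        · simp
      refine ⟨_, (cons_snoc_iff hk _).1 (hrep ▸ hv'.smul _), ?_⟩
      exact (Projectivization.mk_eq_mk_iff' K _ _ _ _).2 ⟨_, hrep.symm⟩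
  · rintro ⟨w, hw, rfl⟩ v hv h
    obtain ⟨c, hc⟩ := (Projectivization.mk_eq_mk_iff' K _ _ _ _).1 h
    exact hc ▸ ((cons_snoc_iff hk w).2 hw).smul c

end FermatConeLastZero


/-- Let `K` be algebraically closed, `k ≥ 2` not divisible by the characteristic, `n ≥ 2`,
and `λ₁,…,λ_{n-2} ∈ K` pairwise distinct with `λᵢ ∉ {0,1}`; set `μ₁ = 1`, `μᵢ = λ_{i-1}`.
Let `ω^k = 1`, `ω ≠ 1`, and let `a_{n+1}` be the automorphism of `ℙⁿ_K` multiplying the last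
coordinate by `ω`. Then a point of the generalized Fermat curve `C` is fixed by `a_{n+1}`
iff its last coordinate vanishes, and the set of points of `C` with vanishing last
coordinate has exactly `k^{n-1}` elements. -/
theorem fixed_points_of_last_generator (K : Type) [Field K] [IsAlgClosed K] (k n : ℕ)
    (hk : 2 ≤ k) (hkK : (k : K) ≠ 0) (hn : 2 ≤ n)
    (lam : Fin (n - 2) → K) (hinj : Function.Injective lam)
    (hlam : ∀ i, lam i ≠ 0 ∧ lam i ≠ 1)
    (ω : K) (hω : ω ^ k = 1) (hω1 : ω ≠ 1) :
    (∀ v : Fin (n + 1) → K, v ≠ 0 →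
      (∀ i : Fin (n - 1),
        (if h : (i : ℕ) = 0 then (1 : K)
          else lam ⟨(i : ℕ) - 1, by have := i.isLt; omega⟩) * v 0 ^ k
          + v 1 ^ k + v ⟨(i : ℕ) + 2, by have := i.isLt; omega⟩ ^ k = 0) →
      ((∃ c : K, c ≠ 0 ∧
          Function.update v (Fin.last n) (ω * v (Fin.last n)) = c • v) ↔
        v (Fin.last n) = 0)) ∧
    Set.ncard
      {P : Projectivization K (Fin (n + 1) → K) |
        ∀ (v : Fin (n + 1) → K) (hv : v ≠ 0), Projectivization.mk K v hv = P →
          (∀ i : Fin (n - 1),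
            (if h : (i : ℕ) = 0 then (1 : K)
              else lam ⟨(i : ℕ) - 1, by have := i.isLt; omega⟩) * v 0 ^ k
              + v 1 ^ k + v ⟨(i : ℕ) + 2, by have := i.isLt; omega⟩ ^ k = 0) ∧
          v (Fin.last n) = 0} = k ^ (n - 1) := by
  obtain ⟨m, rfl⟩ := Nat.exists_eq_add_of_le' hn
  have hk0 : k ≠ 0 := by omega
  constructor
  · intro v hv hC
    constructor
    · rintro ⟨c, hc0, hc⟩
      by_contra hl
      have hcω : ω = c := by
        have := congrFun hc (Fin.last _)
        simp only [Function.update_self, Pi.smul_apply, smul_eq_mul] at this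
        exact mul_right_cancel₀ hl this
      have hz : ∀ j, j ≠ Fin.last (m + 2) → v j = 0 := by
        intro j hj
        have := congrFun hc j
        rw [Function.update_of_ne hj, Pi.smul_apply, smul_eq_mul, ← hcω] at this
        have h' : (ω - 1) * v j = 0 := by linear_combination -this
        exact (mul_eq_zero.1 h').resolve_left (sub_ne_zero.2 hω1)
      have h0 : v 0 = 0 := hz 0 (by simp [Fin.ext_iff])
      have h1 : v 1 = 0 := hz 1 (by simp [Fin.ext_iff])
      have h := hC (Fin.last m)
      rw [h0, h1, zero_pow hk0, mul_zero, zero_add, zero_add] at h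
      exact hl (pow_eq_zero_iff hk0 |>.1 h)
    · intro hl
      exact ⟨1, one_ne_zero, by rw [hl, mul_zero, one_smul, ← hl, Function.update_eq_self]⟩
  · let M : Fin (m + 1) → K := Fin.cons 1 lam
    have hM : ∀ i, M i ≠ 0 := Fin.cases one_ne_zero fun i => (hlam i).1
    have hMinj : Function.Injective M :=
      Fin.cons_injective_iff.2 ⟨fun ⟨i, hi⟩ => (hlam i).2 hi, hinj⟩
    have hMi (i : Fin (m + 1)) : (if h : (i : ℕ) = 0 then (1 : K)
        else lam ⟨(i : ℕ) - 1, by have := i.isLt; omega⟩) = M i := by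
      refine Fin.cases rfl (fun i => rfl) i
    refine Eq.trans ?_ (FermatConeLastZero.ncard_projectivization hkK hMinj hM)
    congr! 8 with P v hv h
    exact and_congr_left' (forall_congr' fun i => by rw [← hMi i]; rfl)
end

section
/- Let F be a field, D : F → F a derivation (additive and satisfying the Leibniz rule D(ab) = a·D(b) + b·D(a)), and k ≥ 1 an integer with k·1_F ≠ 0. Let J be a finite index set, z ∈ F with D(z) = 1, and for each j ∈ J let yⱼ ∈ F be nonzero and δⱼ ∈ F satisfy D(δⱼ) = 0 and yⱼ^k = δⱼ + z^k. Then for every integer r ≥ 1 and all natural numbers αⱼ (j ∈ J): D( z^r · ∏_{j∈J} yⱼ^{−αⱼ} ) = z^{r−1} · ( r·1_F − z^k · ∑_{j∈J} αⱼ·yⱼ^{−k} ) · ∏_{j∈J} yⱼ^{−αⱼ}. -/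
section Leibniz

variable {F : Type} [Field F] {D : F → F}

theorem leibniz_map_one (hmul : ∀ a b : F, D (a * b) = a * D b + b * D a) : D 1 = 0 := by
  simpa using hmul 1 1

theorem leibniz_map_pow (hmul : ∀ a b : F, D (a * b) = a * D b + b * D a) (a : F) (n : ℕ) :
    D (a ^ (n + 1)) = (n + 1) * a ^ n * D a := by
  induction n with
  | zero => simp
  | succ n ih =>
    rw [pow_succ, hmul, ih]
    push_cast
    ring

theorem leibniz_map_inv (hmul : ∀ a b : F, D (a * b) = a * D b + b * D a) {a c : F}
    (ha : a ≠ 0) (h : D a = c * a) : D a⁻¹ = -c * a⁻¹ := by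
  have h1 := hmul a a⁻¹
  rw [mul_inv_cancel₀ ha, leibniz_map_one hmul, h] at h1
  apply mul_left_cancel₀ ha
  linear_combination -h1

theorem leibniz_map_zpow_neg (hmul : ∀ a b : F, D (a * b) = a * D b + b * D a) {a c : F}
    (ha : a ≠ 0) (h : D a = c * a) (n : ℕ) :
    D (a ^ (-(n : ℤ))) = -(n * c) * a ^ (-(n : ℤ)) := by
  rw [zpow_neg, zpow_natCast]
  refine leibniz_map_inv hmul (pow_ne_zero n ha) ?_
  cases n with
  | zero => simp [leibniz_map_one hmul]
  | succ n =>
    rw [leibniz_map_pow hmul, h]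
    push_cast
    ring

theorem leibniz_map_prod (hmul : ∀ a b : F, D (a * b) = a * D b + b * D a) {ι : Type}
    (s : Finset ι) {f c : ι → F} (h : ∀ i, D (f i) = c i * f i) :
    D (∏ i ∈ s, f i) = (∑ i ∈ s, c i) * ∏ i ∈ s, f i := by
  classical
  induction s using Finset.induction_on with
  | empty => simp [leibniz_map_one hmul]
  | insert i s hi ih =>
    rw [Finset.prod_insert hi, Finset.sum_insert hi, hmul, ih, h]
    ring

end Leibniz

/-- Let `F` be a field, `D` a derivation on `F`, and `k ≥ 1` with `k·1_F ≠ 0`. Let `J` be a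
finite index set, `z ∈ F` with `D z = 1`, and for `j ∈ J` let `yⱼ ≠ 0` and `δⱼ` satisfy
`D δⱼ = 0` and `yⱼ^k = δⱼ + z^k`. Then for every `r ≥ 1` and natural numbers `αⱼ`:
`D(z^r ∏ yⱼ^{-αⱼ}) = z^{r-1} (r - z^k ∑ αⱼ yⱼ^{-k}) ∏ yⱼ^{-αⱼ}`. -/
theorem derivation_on_standard_form (F : Type) [Field F] (D : F → F)
    (hadd : ∀ a b : F, D (a + b) = D a + D b)
    (hmul : ∀ a b : F, D (a * b) = a * D b + b * D a)
    (k : ℕ) (hk : 1 ≤ k) (hkF : (k : F) ≠ 0)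
    (J : Type) [Fintype J]
    (z : F) (hz : D z = 1)
    (y δ : J → F) (hy : ∀ j, y j ≠ 0) (hδ : ∀ j, D (δ j) = 0)
    (hyk : ∀ j, y j ^ k = δ j + z ^ k)
    (r : ℕ) (hr : 1 ≤ r) (α : J → ℕ) :
    D (z ^ r * ∏ j, y j ^ (-(α j : ℤ))) =
      z ^ (r - 1) * ((r : F) - z ^ k * ∑ j, (α j : F) * y j ^ (-(k : ℤ))) *
        ∏ j, y j ^ (-(α j : ℤ)) := by
  obtain ⟨m, rfl⟩ : ∃ m, k = m + 1 := ⟨k - 1, by omega⟩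
  obtain ⟨q, rfl⟩ : ∃ q, r = q + 1 := ⟨r - 1, by omega⟩
  have hDy (j : J) : D (y j) = z ^ m * y j ^ (-((m + 1 : ℕ) : ℤ)) * y j := by
    have h := congrArg D (hyk j)
    rw [hadd, hδ, leibniz_map_pow hmul, leibniz_map_pow hmul, hz] at h
    push_cast at hkF
    have h2 : y j ^ m * D (y j) = z ^ m := mul_left_cancel₀ hkF (by linear_combination h)
    have := hy j
    rw [← h2, zpow_neg, zpow_natCast]
    field_simp
    ring
  rw [hmul, leibniz_map_pow hmul, hz,
    leibniz_map_prod hmul _ fun j => leibniz_map_zpow_neg hmul (hy j) (hDy j) (α j)]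
  have hsum : ∑ j, -((α j : F) * (z ^ m * y j ^ (-((m + 1 : ℕ) : ℤ)))) =
      -(z ^ m * ∑ j, (α j : F) * y j ^ (-((m + 1 : ℕ) : ℤ))) := by
    rw [Finset.sum_neg_distrib, Finset.mul_sum]
    exact congrArg _ (Finset.sum_congr rfl fun j _ => by ring)
  rw [hsum, Nat.add_sub_cancel, Nat.cast_add_one q]
  ring
end

section
/- Let F be a field of characteristic 3 and D : F → F a derivation (additive and satisfying the Leibniz rule). Let z, y₃, y₄, y₅ ∈ F with y₃·y₄·y₅ ≠ 0 and D(z) = 1, and let λ₁, λ₂ ∈ F with D(λ₁) = D(λ₂) = 0 satisfy y₃² = 1 + z², y₄² = λ₁ + z², y₅² = λ₂ + z². Then D(D( (y₃·y₄·y₅)⁻¹ )) = −(λ₁ + λ₂ + λ₁·λ₂) · (y₃·y₄·y₅)⁻³. (This computes the image under the Cartier operator of the holomorphic form θ₁ = dz/(y₃y₄y₅) on a classical Humbert curve in characteristic 3: 𝒞(θ₁) = (λ₁+λ₂+λ₁λ₂)^{1/3}·θ₁.) -/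
/-- Cartier operator on the classical Humbert curve in characteristic 3: with
`z, y₃, y₄, y₅` satisfying `y₃² = 1 + z²`, `y₄² = λ₁ + z²`, `y₅² = λ₂ + z²` and `D z = 1`,
one has `D(D((y₃y₄y₅)⁻¹)) = -(λ₁ + λ₂ + λ₁λ₂) · ((y₃y₄y₅)⁻¹)³`, i.e.
`𝒞(θ₁) = (λ₁+λ₂+λ₁λ₂)^{1/3} θ₁` for `θ₁ = dz/(y₃y₄y₅)`. -/
theorem cartier_humbert_theta_one (F : Type) [Field F] [CharP F 3] (D : F → F)
    (hadd : ∀ a b : F, D (a + b) = D a + D b)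
    (hmul : ∀ a b : F, D (a * b) = a * D b + b * D a)
    (z y₃ y₄ y₅ l₁ l₂ : F) (hy : y₃ * y₄ * y₅ ≠ 0) (hz : D z = 1)
    (hl₁ : D l₁ = 0) (hl₂ : D l₂ = 0)
    (h₃ : y₃ ^ 2 = 1 + z ^ 2) (h₄ : y₄ ^ 2 = l₁ + z ^ 2) (h₅ : y₅ ^ 2 = l₂ + z ^ 2) :
    D (D ((y₃ * y₄ * y₅)⁻¹)) = -(l₁ + l₂ + l₁ * l₂) * ((y₃ * y₄ * y₅)⁻¹) ^ 3 := by
  have h3 : (3 : F) = 0 := by exact_mod_cast CharP.cast_eq_zero F 3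
  have hone : D 1 = 0 := by simpa using hmul 1 1
  have hcube (u : F) : D (u ^ 3) = 0 := by
    rw [pow_succ, pow_two, hmul, hmul]
    linear_combination (u ^ 2 * D u) * h3
  have hcube_mul (a u : F) : D (a * u ^ 3) = D a * u ^ 3 := by
    rw [hmul, hcube]
    ring
  have hinv : (y₃ * y₄ * y₅)⁻¹ =
      (1 + z * z) * (l₁ + z * z) * (l₂ + z * z) * ((y₃ * y₄ * y₅)⁻¹) ^ 3 := by
    have hsq : (1 + z * z) * (l₁ + z * z) * (l₂ + z * z) = (y₃ * y₄ * y₅) ^ 2 := by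
      rw [mul_pow, mul_pow, h₃, h₄, h₅]
      ring
    rw [hsq]
    field_simp
  rw [hinv, hcube_mul, hcube_mul, ← hinv]
  congr 1
  simp only [hadd, hmul, hz, hl₁, hl₂, hone, mul_one, zero_add]
  linear_combination
    (10 * z ^ 4 + 4 * (1 + l₁ + l₂) * z ^ 2 + (l₁ + l₂ + l₁ * l₂)) * h3
end

section
/- Let F be a field of characteristic 3 and D : F → F a derivation (additive and satisfying the Leibniz rule). Let z, y₃, y₄, y₅ ∈ F with y₃·y₄·y₅ ≠ 0 and D(z) = 1, and let λ₁, λ₂ ∈ F with D(λ₁) = D(λ₂) = 0 satisfy y₃² = 1 + z², y₄² = λ₁ + z², y₅² = λ₂ + z². Then D(D( z·(y₃·y₄·y₅)⁻¹ )) = −(1 + λ₁ + λ₂) · z³ · (y₃·y₄·y₅)⁻³. (This computes the image under the Cartier operator of the holomorphic form θ₂ = z·dz/(y₃y₄y₅) on a classical Humbert curve in characteristic 3: 𝒞(θ₂) = (1+λ₁+λ₂)^{1/3}·θ₂.) -/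
/-- Cartier operator on the classical Humbert curve in characteristic 3: with
`z, y₃, y₄, y₅` satisfying `y₃² = 1 + z²`, `y₄² = λ₁ + z²`, `y₅² = λ₂ + z²` and `D z = 1`,
one has `D(D(z·(y₃y₄y₅)⁻¹)) = -(1 + λ₁ + λ₂) · z³ · ((y₃y₄y₅)⁻¹)³`, i.e.
`𝒞(θ₂) = (1+λ₁+λ₂)^{1/3} θ₂` for `θ₂ = z dz/(y₃y₄y₅)`. -/
theorem cartier_humbert_theta_two (F : Type) [Field F] [CharP F 3] (D : F → F)
    (hadd : ∀ a b : F, D (a + b) = D a + D b)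
    (hmul : ∀ a b : F, D (a * b) = a * D b + b * D a)
    (z y₃ y₄ y₅ l₁ l₂ : F) (hy : y₃ * y₄ * y₅ ≠ 0) (hz : D z = 1)
    (hl₁ : D l₁ = 0) (hl₂ : D l₂ = 0)
    (h₃ : y₃ ^ 2 = 1 + z ^ 2) (h₄ : y₄ ^ 2 = l₁ + z ^ 2) (h₅ : y₅ ^ 2 = l₂ + z ^ 2) :
    D (D (z * (y₃ * y₄ * y₅)⁻¹)) =
      -(1 + l₁ + l₂) * z ^ 3 * ((y₃ * y₄ * y₅)⁻¹) ^ 3 := by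
  have h3 : (3 : F) = 0 := CharP.cast_eq_zero F 3
  have hone : D 1 = 0 := by
    have h := hmul 1 1
    simp only [mul_one, one_mul] at h
    linear_combination -h
  have hcube (a : F) : D (a ^ 3) = 0 := by
    rw [pow_three, hmul, hmul]
    linear_combination a * a * D a * h3
  obtain ⟨w, hw⟩ : ∃ w, w = y₃ * y₄ * y₅ := ⟨_, rfl⟩
  rw [← hw] at hy ⊢
  have hsq : w * w = (1 + z * z) * (l₁ + z * z) * (l₂ + z * z) := by
    simp only [← pow_two, ← h₃, ← h₄, ← h₅, hw]
    ring
  have hconst : D (w⁻¹ ^ 3) = 0 := hcube _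
  have hform : z * w⁻¹ = w⁻¹ ^ 3 * (z * ((1 + z * z) * (l₁ + z * z) * (l₂ + z * z))) := by
    rw [← hsq]
    field_simp
  rw [hform]
  generalize w⁻¹ ^ 3 = u at hconst ⊢
  simp only [hmul, hadd, hz, hl₁, hl₂, hone, hconst, mul_zero, mul_one, zero_add, add_zero]
  linear_combination u * (14 * z ^ 5 + 7 * (1 + l₁ + l₂) * z ^ 3
    + 2 * (l₁ + l₂ + l₁ * l₂) * z) * h3
end
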